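/- Let X ⊂ M be a finite set such that τ(a*x) = 0 for all x ∈ X and all a ∈ A. Then for every ε > 0 there exists a nonzero projection q ∈ A such that ‖q x q‖₁ ≤ ε·τ(q) for every x ∈ X. -/

import Mathlib

open scoped ComplexOrder

noncomputable section

/-- The weak operator topology on `H →L[ℂ] H`: the topology induced by the maps
`T ↦ ⟪T x, y⟫`. -/
def wot (H : Type*) [NormedAddCommGroup H] [InnerProductSpace ℂ H] :
    TopologicalSpace (H →L[ℂ] H) :=
  TopologicalSpace.induced (fun T => fun xy : H × H => (@inner ℂ H _ (T xy.1) xy.2)) inferInstance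

variable {H : Type*} [NormedAddCommGroup H] [InnerProductSpace ℂ H] [CompleteSpace H]

/-- The `L¹`-norm `‖x‖₁ = τ((x⋆x)^{1/2})` associated with `τ`. -/
def norm1 (τ : (H →L[ℂ] H) → ℂ) (x : H →L[ℂ] H) : ℝ := (τ (CFC.sqrt (star x * x))).re

/-- `τ` is a faithful normal tracial state on the von Neumann algebra `M`. -/
structure IsFaithfulNormalTracialState (M : VonNeumannAlgebra H)
    (τ : (H →L[ℂ] H) → ℂ) : Prop where
  add : ∀ x ∈ M, ∀ y ∈ M, τ (x + y) = τ x + τ y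
  smul : ∀ (c : ℂ), ∀ x ∈ M, τ (c • x) = c * τ x
  one : τ 1 = 1
  trace : ∀ x ∈ M, ∀ y ∈ M, τ (x * y) = τ (y * x)
  pos : ∀ x ∈ M, 0 ≤ τ (star x * x)
  faithful : ∀ x ∈ M, τ (star x * x) = 0 → x = 0
  normal : @ContinuousOn _ _ (wot H) _ τ ((M : Set (H →L[ℂ] H)) ∩ Metric.closedBall 0 1)

/-- `A` is a maximal abelian *-subalgebra of `M`: `A` consists exactly of the elements of `M`
commuting with `A`. -/
def IsMasa (M : VonNeumannAlgebra H) (A : StarSubalgebra ℂ (H →L[ℂ] H)) : Prop :=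
  ∀ x : H →L[ℂ] H, x ∈ A ↔ (x ∈ M ∧ ∀ a ∈ A, a * x = x * a)

open Filter Topology
open scoped InnerProductSpace

omit [CompleteSpace H] in
/-- Weak operator convergence is convergence of all matrix coefficients. -/
theorem tendsto_wot_of_inner {ι : Type*} {G : Filter ι} {z : ι → H →L[ℂ] H} {y : H →L[ℂ] H}
    (h : ∀ v w : H, Tendsto (fun i => ⟪z i v, w⟫_ℂ) G (𝓝 ⟪y v, w⟫_ℂ)) :
    Tendsto z G (@nhds _ (wot H) y) := by
  rw [wot, nhds_induced, tendsto_comap_iff, tendsto_pi_nhds]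
  exact fun p => h p.1 p.2

/-- Bounded families of operators converge in the weak operator topology along ultrafilters. -/
theorem exists_wot_limit {ι : Type*} (G : Ultrafilter ι) (z : ι → H →L[ℂ] H) (C : ℝ)
    (hz : ∀ i, ‖z i‖ ≤ C) :
    ∃ y : H →L[ℂ] H, ∀ v w : H, Tendsto (fun i => ⟪z i v, w⟫_ℂ) G (𝓝 ⟪y v, w⟫_ℂ) := by
  have hb (i : ι) (v w : H) : ‖⟪z i v, w⟫_ℂ‖ ≤ C * ‖v‖ * ‖w‖ :=
    (norm_inner_le_norm _ _).trans <| by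
      gcongr
      exact (z i).le_of_opNorm_le (hz i) v
  have hex (v w : H) : ∃ c : ℂ, ‖c‖ ≤ C * ‖v‖ * ‖w‖ ∧
      Tendsto (fun i => ⟪z i v, w⟫_ℂ) G (𝓝 c) := by
    obtain ⟨c, hc, hlim⟩ := (isCompact_closedBall (0 : ℂ) (C * ‖v‖ * ‖w‖)).ultrafilter_le_nhds'
      (G.map fun i => ⟪z i v, w⟫_ℂ)
      (Ultrafilter.mem_map.2 (Filter.univ_mem' fun i => by simpa using hb i v w))
    exact ⟨c, by simpa using hc, hlim⟩
  choose B hBnorm hB using hex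
  let L : H →L⋆[ℂ] H →L[ℂ] ℂ := LinearMap.mkContinuous₂ (LinearMap.mk₂'ₛₗ (starRingEnd ℂ)
    (RingHom.id ℂ) B
    (fun u v w => tendsto_nhds_unique (hB _ _) <| by
      simpa [inner_add_left] using (hB u w).add (hB v w))
    (fun c v w => tendsto_nhds_unique (hB _ _) <| by
      simpa [inner_smul_left, mul_comm] using (hB v w).const_mul (starRingEnd ℂ c))
    (fun u v w => tendsto_nhds_unique (hB _ _) <| by
      simpa [inner_add_right] using (hB u v).add (hB u w))
    (fun c v w => tendsto_nhds_unique (hB _ _) <| by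
      simpa [inner_smul_right] using (hB v w).const_mul c)) C hBnorm
  refine ⟨InnerProductSpace.continuousLinearMapOfBilin L, fun v w => ?_⟩
  rw [InnerProductSpace.continuousLinearMapOfBilin_apply]
  exact hB v w

/-- A weak operator limit of operators commuting with `b` commutes with `b`. -/
theorem commute_of_wot_limit {ι : Type*} {G : Filter ι} [G.NeBot] {z : ι → H →L[ℂ] H}
    {y b : H →L[ℂ] H}
    (h : ∀ v w : H, Tendsto (fun i => ⟪z i v, w⟫_ℂ) G (𝓝 ⟪y v, w⟫_ℂ))
    (hb : ∀ᶠ i in G, Commute b (z i)) : Commute b y := by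
  refine ContinuousLinearMap.ext fun v => ext_inner_right ℂ fun w => ?_
  have h1 := h v (star b w)
  have h2 := h (b v) w
  simp only [ContinuousLinearMap.star_eq_adjoint, ContinuousLinearMap.adjoint_inner_right] at h1
  refine tendsto_nhds_unique (h1.congr' ?_) h2
  filter_upwards [hb] with i hi
  exact congrArg (fun T : H →L[ℂ] H => ⟪T v, w⟫_ℂ) hi.eq

/-- A von Neumann algebra contains everything commuting with its commutant. -/
theorem VonNeumannAlgebra.mem_of_forall_commute {M : VonNeumannAlgebra H} {x : H →L[ℂ] H}
    (h : ∀ b ∈ M.commutant, Commute b x) : x ∈ M := by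
  rw [← M.commutant_commutant, VonNeumannAlgebra.mem_commutant_iff]
  exact h

theorem VonNeumannAlgebra.commute_of_mem_commutant {M : VonNeumannAlgebra H} {x b : H →L[ℂ] H}
    (hx : x ∈ M) (hb : b ∈ M.commutant) : Commute b x :=
  (VonNeumannAlgebra.mem_commutant_iff.1 hb x hx).symm

theorem VonNeumannAlgebra.smul_mem' (M : VonNeumannAlgebra H) (c : ℂ) {x : H →L[ℂ] H}
    (hx : x ∈ M) : c • x ∈ M :=
  mem_of_forall_commute fun _ hb => (commute_of_mem_commutant hx hb).smul_right c

/-- A von Neumann algebra is weak operator closed. -/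
theorem VonNeumannAlgebra.mem_of_wot_limit {M : VonNeumannAlgebra H} {ι : Type*} {G : Filter ι}
    [G.NeBot] {z : ι → H →L[ℂ] H} {y : H →L[ℂ] H} (hz : ∀ i, z i ∈ M)
    (h : ∀ v w : H, Tendsto (fun i => ⟪z i v, w⟫_ℂ) G (𝓝 ⟪y v, w⟫_ℂ)) : y ∈ M :=
  mem_of_forall_commute fun _ hb =>
    commute_of_wot_limit h (.of_forall fun i => commute_of_mem_commutant (hz i) hb)

namespace IsFaithfulNormalTracialState

variable {M : VonNeumannAlgebra H} {τ : (H →L[ℂ] H) → ℂ}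

theorem zero (hτ : IsFaithfulNormalTracialState M τ) : τ 0 = 0 := by
  simpa using hτ.smul 0 0 (zero_mem M)

theorem sub (hτ : IsFaithfulNormalTracialState M τ) {x y : H →L[ℂ] H} (hx : x ∈ M)
    (hy : y ∈ M) : τ (x - y) = τ x - τ y := by
  rw [eq_sub_iff_add_eq, ← hτ.add _ (sub_mem hx hy) _ hy, sub_add_cancel]

theorem list_sum (hτ : IsFaithfulNormalTracialState M τ) (l : List (H →L[ℂ] H))
    (hl : ∀ x ∈ l, x ∈ M) : τ l.sum = (l.map τ).sum := by
  induction l with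
  | nil => simpa using hτ.zero
  | cons a l ih =>
    simp only [List.mem_cons, forall_eq_or_imp] at hl
    rw [List.sum_cons, hτ.add _ hl.1 _ (list_sum_mem hl.2), ih hl.2, List.map_cons, List.sum_cons]

/-- `τ` is weak operator continuous along bounded families in `M`. -/
theorem tendsto_of_wot (hτ : IsFaithfulNormalTracialState M τ) {ι : Type*} {G : Filter ι}
    {z : ι → H →L[ℂ] H} {y : H →L[ℂ] H} (hz : ∀ i, z i ∈ M) (hy : y ∈ M) (C : ℝ)
    (hzC : ∀ i, ‖z i‖ ≤ C)
    (h : ∀ v w : H, Tendsto (fun i => ⟪z i v, w⟫_ℂ) G (𝓝 ⟪y v, w⟫_ℂ)) :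
    Tendsto (fun i => τ (z i)) G (𝓝 (τ y)) := by
  set D : ℝ := max 1 (max C ‖y‖) with hD
  have hD0 : 0 < D := lt_max_of_lt_left one_pos
  have hD0' : (D : ℂ) ≠ 0 := by exact_mod_cast hD0.ne'
  set c : ℂ := (D : ℂ)⁻¹ with hc
  have key {x : H →L[ℂ] H} (hx : x ∈ M) (hxD : ‖x‖ ≤ D) :
      c • x ∈ (M : Set (H →L[ℂ] H)) ∩ Metric.closedBall 0 1 := by
    refine ⟨M.smul_mem' c hx, ?_⟩
    rw [mem_closedBall_zero_iff, norm_smul, hc, norm_inv, Complex.norm_real, Real.norm_eq_abs,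
      abs_of_pos hD0]
    rwa [inv_mul_le_one₀ hD0]
  have hlim : Tendsto (fun i => c • z i) G (@nhds _ (wot H) (c • y)) :=
    tendsto_wot_of_inner fun v w => by
      simpa [inner_smul_left, mul_comm] using (h v w).const_mul (starRingEnd ℂ c)
  have hcont : Tendsto τ (@nhdsWithin _ (wot H) (c • y)
      ((M : Set (H →L[ℂ] H)) ∩ Metric.closedBall 0 1)) (𝓝 (τ (c • y))) :=
    hτ.normal (c • y) (key hy ((le_max_right _ _).trans (le_max_right _ _)))
  have := hcont.comp (tendsto_inf.2 ⟨hlim, tendsto_principal.2 (.of_forall fun i =>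
    key (hz i) ((hzC i).trans ((le_max_left _ _).trans (le_max_right _ _))))⟩)
  have h2 := this.const_mul (D : ℂ)
  simp only [Function.comp_def, hτ.smul _ _ hy, hτ.smul _ _ (hz _), hc,
    mul_inv_cancel_left₀ hD0'] at h2
  exact h2

end IsFaithfulNormalTracialState

/-- The projection onto the kernel of `h`, characterised algebraically. -/
theorem exists_kernel_projection (h : H →L[ℂ] H) :
    ∃ e : H →L[ℂ] H, star e = e ∧ e * e = e ∧ h * e = 0 ∧
      ∀ T : H →L[ℂ] H, h * T = 0 → e * T = T := by
  have hK : IsClosed (h.ker : Set H) := h.isClosed_ker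
  have : CompleteSpace h.ker := hK.completeSpace_coe
  refine ⟨h.ker.starProjection, isStarProjection_starProjection.isSelfAdjoint.star_eq,
    isStarProjection_starProjection.isIdempotentElem.eq, ?_, fun T hT => ?_⟩
  · ext v
    exact Submodule.starProjection_apply_mem h.ker v
  · ext v
    exact Submodule.starProjection_eq_self_iff.2 (DFunLike.congr_fun hT v)

namespace IsMasa

variable {M : VonNeumannAlgebra H} {A : StarSubalgebra ℂ (H →L[ℂ] H)}

theorem commute (hA : IsMasa M A) {a b : H →L[ℂ] H} (ha : a ∈ A) (hb : b ∈ A) : Commute a b :=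
  ((hA b).1 hb).2 a ha

theorem mem_of_forall_commute (hA : IsMasa M A) {b T : H →L[ℂ] H} (hb : b ∈ A)
    (hT : ∀ S, Commute b S → Commute S T) : T ∈ A :=
  (hA T).2 ⟨VonNeumannAlgebra.mem_of_forall_commute fun S hS => hT S
    (VonNeumannAlgebra.commute_of_mem_commutant ((hA b).1 hb).1 hS).symm,
    fun a ha => hT a (hA.commute hb ha)⟩

/-- For a selfadjoint contraction `b ∈ A` the projection `e` onto the kernel of `b⁺` lies in `A`,
and `0 ≤ b + e ≤ 1`. -/
theorem exists_projection_add (hA : IsMasa M A) {b : H →L[ℂ] H} (hb : b ∈ A)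
    (hbs : IsSelfAdjoint b) (h₁ : 0 ≤ 1 - b) (h₂ : 0 ≤ 1 + b) :
    ∃ e ∈ A, star e = e ∧ e * e = e ∧ 0 ≤ b + e ∧ 0 ≤ 1 - (b + e) := by
  obtain ⟨e, hes, hee, hhe, hker⟩ := exists_kernel_projection b⁺
  have hp : (0 : H →L[ℂ] H) ≤ b⁺ := CFC.posPart_nonneg b
  have hn : (0 : H →L[ℂ] H) ≤ b⁻ := CFC.negPart_nonneg b
  have hps : star b⁺ = b⁺ := (IsSelfAdjoint.of_nonneg hp).star_eq
  have hns : star b⁻ = b⁻ := (IsSelfAdjoint.of_nonneg hn).star_eq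
  have heh : e * b⁺ = 0 := by simpa [hes, hps] using congrArg star hhe
  have hen : e * b⁻ = b⁻ := hker _ (CFC.posPart_mul_negPart b)
  have hne : b⁻ * e = b⁻ := by simpa [hes, hns] using congrArg star hen
  have hbe : b = b⁺ - b⁻ := (CFC.posPart_sub_negPart b hbs).symm
  have hinv {S : H →L[ℂ] H} (hS : Commute b S) : e * (S * e) = S * e := by
    refine hker _ ?_
    have : Commute b⁺ S := hS.cfcₙ_real _
    rw [← mul_assoc, this.eq, mul_assoc, hhe, mul_zero]
  refine ⟨e, hA.mem_of_forall_commute hb fun S hS => ?_, hes, hee, ?_, ?_⟩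
  · have hS' : Commute b (star S) := by
      simpa [hbs.star_eq] using hS.star_star
    have := congrArg star (hinv hS')
    simp only [star_mul, star_star, hes] at this
    rw [commute_iff_eq, ← hinv hS, ← mul_assoc, this]
  · have h := star_left_conjugate_nonneg h₂ e
    have : b + e = b⁺ + star e * (1 + b) * e := by
      rw [hes, mul_add, mul_one, add_mul, hee, hbe, mul_sub, heh, hen, sub_mul, zero_mul, hne,
        ← hbe]
      nth_rw 1 [hbe]
      abel
    rw [this]
    exact add_nonneg hp h
  · have h := star_left_conjugate_nonneg h₁ (1 - e)
    have : 1 - (b + e) = b⁻ + star (1 - e) * (1 - b) * (1 - e) := by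
      have hbe' : b * e = -b⁻ := by rw [hbe, sub_mul, hhe, hne, zero_sub, ← hbe]
      have heb : e * b = -b⁻ := by rw [hbe, mul_sub, heh, hen, zero_sub, ← hbe]
      rw [star_sub, star_one, hes]
      simp only [mul_sub, sub_mul, mul_one, one_mul, hee, hbe', heb]
      simp only [neg_mul, hne]
      abel
    rw [this]
    exact add_nonneg hn h

theorem norm_commutator_le (hA : IsMasa M A) {y : H →L[ℂ] H}
    (hy : ∀ e ∈ A, star e = e → e * e = e → Commute e y) (n : ℕ) :
    ∀ b ∈ A, IsSelfAdjoint b → 0 ≤ 1 - b → 0 ≤ 1 + b →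
      ‖b * y - y * b‖ ≤ 4 * ‖y‖ / 2 ^ n := by
  induction n with
  | zero =>
    intro b hb hbs h₁ h₂
    have hnorm : ‖1 + b‖ ≤ 2 := by
      refine (CStarAlgebra.norm_le_iff_le_algebraMap (1 + b) zero_le_two h₂).2 ?_
      rw [← sub_nonneg, map_ofNat]
      convert h₁ using 1
      rw [← one_add_one_eq_two]
      abel
    have : b * y - y * b = (1 + b) * y - y * (1 + b) := by
      rw [add_mul, mul_add, one_mul, mul_one]
      abel
    rw [this, pow_zero, div_one]
    calc _ ≤ ‖1 + b‖ * ‖y‖ + ‖y‖ * ‖1 + b‖ :=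
          (norm_sub_le _ _).trans (add_le_add (norm_mul_le _ _) (norm_mul_le _ _))
      _ ≤ 2 * ‖y‖ + ‖y‖ * 2 := by gcongr
      _ = 4 * ‖y‖ := by ring
  | succ n ih =>
    intro b hb hbs h₁ h₂
    obtain ⟨e, he, hes, hee, h₃, h₄⟩ := hA.exists_projection_add hb hbs h₁ h₂
    have hbe := add_mem hb he
    have hs : IsSelfAdjoint (b + e) := hbs.add hes
    have := ih ((b + e) + (b + e) - 1) (sub_mem (add_mem hbe hbe) (one_mem A))
      ((hs.add hs).sub (.one _))
      (by convert add_nonneg h₄ h₄ using 1; abel) (by convert add_nonneg h₃ h₃ using 1; abel)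
    have heq : ((b + e) + (b + e) - 1) * y - y * ((b + e) + (b + e) - 1)
        = (b * y - y * b) + (b * y - y * b) := by
      simp only [sub_mul, mul_sub, add_mul, mul_add, one_mul, mul_one, (hy e he hes hee).eq]
      abel
    rw [heq, ← two_smul ℝ, norm_smul, Real.norm_ofNat] at this
    rw [pow_succ, ← div_div, le_div_iff₀ two_pos]
    linarith

/-- An operator commuting with the projections of a MASA commutes with the MASA. -/
theorem commute_of_commute_projections (hA : IsMasa M A) {y : H →L[ℂ] H}
    (hy : ∀ e ∈ A, star e = e → e * e = e → Commute e y) {a : H →L[ℂ] H} (ha : a ∈ A) :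
    Commute a y := by
  have hcontr {b : H →L[ℂ] H} (hb : b ∈ A) (hbs : IsSelfAdjoint b) (h₁ : 0 ≤ 1 - b)
      (h₂ : 0 ≤ 1 + b) : Commute b y := by
    have hlim : Tendsto (fun n : ℕ => 4 * ‖y‖ / 2 ^ n) atTop (𝓝 0) :=
      tendsto_const_nhds.div_atTop (tendsto_pow_atTop_atTop_of_one_lt one_lt_two)
    have := ge_of_tendsto' hlim fun n => hA.norm_commutator_le hy n b hb hbs h₁ h₂
    exact sub_eq_zero.1 (norm_le_zero_iff.1 this)
  have hreal (r : ℝ) {b : H →L[ℂ] H} (hb : b ∈ A) : r • b ∈ A := by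
    rw [← Complex.coe_smul]
    exact SMulMemClass.smul_mem (r : ℂ) hb
  have hsa {b : H →L[ℂ] H} (hb : b ∈ A) (hbs : IsSelfAdjoint b) : Commute b y := by
    have hr : 0 < ‖b‖ + 1 := by positivity
    have h₁ : 0 ≤ (‖b‖ + 1) • (1 : H →L[ℂ] H) - b := by
      have h := sub_nonneg.2 hbs.le_algebraMap_norm_self
      rw [Algebra.algebraMap_eq_smul_one] at h
      convert add_nonneg h (zero_le_one' (H →L[ℂ] H)) using 1
      rw [add_smul, one_smul]
      abel
    have h₂ : 0 ≤ (‖b‖ + 1) • (1 : H →L[ℂ] H) + b := by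
      have h := sub_nonneg.2 hbs.neg_algebraMap_norm_le_self
      rw [Algebra.algebraMap_eq_smul_one] at h
      convert add_nonneg h (zero_le_one' (H →L[ℂ] H)) using 1
      rw [add_smul, one_smul]
      abel
    have hscale : (‖b‖ + 1)⁻¹ • (‖b‖ + 1) • (1 : H →L[ℂ] H) = 1 := inv_smul_smul₀ hr.ne' _
    have := hcontr (b := (‖b‖ + 1)⁻¹ • b)
      (hreal _ hb)
      (.smul (.all _) hbs)
      (by simpa [smul_sub, hscale] using smul_nonneg (inv_nonneg.2 hr.le) h₁)
      (by simpa [smul_add, hscale] using smul_nonneg (inv_nonneg.2 hr.le) h₂)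
    simpa [inv_smul_smul₀, smul_inv_smul₀ hr.ne'] using this.smul_left (‖b‖ + 1)
  rw [← realPart_add_I_smul_imaginaryPart a]
  have hstar := star_mem ha
  refine .add_left (hsa ?_ (realPart a).2) (.smul_left (hsa ?_ (imaginaryPart a).2) _)
  · rw [realPart_apply_coe]
    exact hreal _ (add_mem ha hstar)
  · rw [imaginaryPart_apply_coe]
    exact SMulMemClass.smul_mem (-Complex.I) (hreal _ (sub_mem ha hstar))

end IsMasa

/-- Every finite set of projections of a MASA is dominated by a partition of unity `P` into
projections of the MASA: the pinching by `P` is contractive with values commuting with the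
given projections. -/
theorem IsMasa.exists_partition {M : VonNeumannAlgebra H} {A : StarSubalgebra ℂ (H →L[ℂ] H)}
    (hA : IsMasa M A) (F : Finset {q : H →L[ℂ] H // q ∈ A ∧ star q = q ∧ q * q = q}) :
    ∃ P : List (H →L[ℂ] H), (∀ p ∈ P, p ∈ A ∧ star p = p ∧ p * p = p) ∧ P.sum = 1 ∧
      ∀ x, ‖(P.map fun p => p * x * p).sum‖ ≤ ‖x‖ ∧
        ∀ q ∈ F, Commute q.1 (P.map fun p => p * x * p).sum := by
  classical
  induction F using Finset.induction_on with
  | empty => exact ⟨[1], by simp [one_mem A], by simp, by simp⟩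
  | insert q F _ ih =>
    obtain ⟨P, hP, hsum, hx⟩ := ih
    obtain ⟨q, hqA, hqs, hqq⟩ := q
    have hr : (1 - q) ∈ A ∧ star (1 - q) = 1 - q ∧ (1 - q) * (1 - q) = 1 - q :=
      ⟨sub_mem (one_mem A) hqA, by rw [star_sub, star_one, hqs],
        by simp [sub_mul, mul_sub, hqq]⟩
    have hproj {r p : H →L[ℂ] H} (hr : r ∈ A ∧ star r = r ∧ r * r = r) (hp : p ∈ P) :
        p * r ∈ A ∧ star (p * r) = p * r ∧ (p * r) * (p * r) = p * r := by
      obtain ⟨hpA, hps, hpp⟩ := hP p hp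
      have hc := (hA.commute hr.1 hpA).eq
      refine ⟨mul_mem hpA hr.1, by rw [star_mul, hps, hr.2.1, hc], ?_⟩
      rw [mul_assoc, ← mul_assoc r, hc, mul_assoc p r, hr.2.2, ← mul_assoc, hpp]
    have hpinch {r : H →L[ℂ] H} (hr : r ∈ A) (x : H →L[ℂ] H) :
        ((P.map (· * r)).map fun p => p * x * p).sum
          = r * (P.map fun p => p * x * p).sum * r := by
      rw [← List.sum_map_mul_left, List.map_map, ← List.sum_map_mul_right]
      congr 1
      refine List.map_congr_left fun p hp => ?_
      have hc := (hA.commute hr (hP p hp).1).eq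
      simp only [Function.comp_apply]
      rw [← hc]
      simp only [mul_assoc]
      rw [← hc]
    refine ⟨P.map (· * q) ++ P.map (· * (1 - q)), ?_, ?_, fun x => ?_⟩
    · simp only [List.mem_append, List.mem_map]
      rintro _ (⟨p, hp, rfl⟩ | ⟨p, hp, rfl⟩)
      · exact hproj ⟨hqA, hqs, hqq⟩ hp
      · exact hproj hr hp
    · rw [List.sum_append, List.sum_map_mul_right, List.sum_map_mul_right, List.map_id', hsum]
      simp
    · obtain ⟨hxn, hxc⟩ := hx x
      rw [List.map_append, List.sum_append, hpinch hqA, hpinch hr.1]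
      generalize (P.map fun p => p * x * p).sum = z at hxn hxc ⊢
      have hqr : q * (1 - q) = 0 := by rw [mul_sub, mul_one, hqq, sub_self]
      have hrq : (1 - q) * q = 0 := by rw [sub_mul, one_mul, hqq, sub_self]
      refine ⟨?_, fun q' hq' => ?_⟩
      · have hu : star (q + q - 1) * (q + q - 1) = 1 := by
          simp only [star_sub, star_add, hqs, star_one, sub_mul, mul_sub, add_mul, mul_add, hqq,
            mul_one, one_mul]
          abel
        have hun : ‖q + q - 1‖ ≤ 1 := by
          have h := CStarRing.norm_star_mul_self (x := q + q - 1)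
          rw [hu] at h
          have h1 : ‖(1 : H →L[ℂ] H)‖ ≤ 1 := ContinuousLinearMap.norm_id_le
          nlinarith [norm_nonneg (q + q - 1)]
        have hz : q * z * q + (1 - q) * z * (1 - q)
            = (2⁻¹ : ℝ) • (z + (q + q - 1) * z * (q + q - 1)) := by
          rw [eq_inv_smul_iff₀ two_ne_zero, two_smul]
          simp only [sub_mul, mul_sub, add_mul, mul_add, mul_one, one_mul]
          abel
        rw [hz, norm_smul, norm_inv, Real.norm_ofNat]
        have h2 : ‖(q + q - 1) * z * (q + q - 1)‖ ≤ 1 * ‖z‖ * 1 :=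
          (norm_mul_le _ _).trans (mul_le_mul ((norm_mul_le _ _).trans (by gcongr)) hun
            (norm_nonneg _) (by positivity))
        linarith [norm_add_le z ((q + q - 1) * z * (q + q - 1))]
      · rcases Finset.mem_insert.1 hq' with rfl | hq'
        · change Commute q _
          rw [commute_iff_eq]
          simp only [mul_add, add_mul, mul_assoc, hqq, hrq, mul_zero, add_zero]
          simp only [← mul_assoc, hqq, hqr, zero_mul, add_zero]
        · have h1 := hA.commute q'.2.1 hqA
          have h2 := hA.commute q'.2.1 hr.1
          have h3 := hxc q' hq'
          exact ((h1.mul_right h3).mul_right h1).add_right ((h2.mul_right h3).mul_right h2)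

namespace IsFaithfulNormalTracialState

variable {M : VonNeumannAlgebra H} {τ : (H →L[ℂ] H) → ℂ}

/-- Cauchy–Schwarz in the form needed for a corner: `2 t ‖z‖₁ ≤ ‖z‖₂² + t² τ(p)` when `z p = z`. -/
theorem two_mul_norm1_le (hτ : IsFaithfulNormalTracialState M τ) {z p : H →L[ℂ] H} (hz : z ∈ M)
    (hp : p ∈ M) (hps : star p = p) (hpp : p * p = p) (hzp : z * p = z) (t : ℝ) :
    2 * t * norm1 τ z ≤ (τ (star z * z)).re + t ^ 2 * (τ p).re := by
  unfold norm1
  set h := CFC.sqrt (star z * z) with hh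
  have hzz : star z * z ∈ M := mul_mem (star_mem hz) hz
  have h0 : 0 ≤ h := CFC.sqrt_nonneg _
  have hs : star h = h := (IsSelfAdjoint.of_nonneg h0).star_eq
  have hsq : h * h = star z * z := CFC.sqrt_mul_sqrt_self _ (star_mul_self_nonneg z)
  have hM : h ∈ M := VonNeumannAlgebra.mem_of_forall_commute fun b hb => by
    have := (VonNeumannAlgebra.commute_of_mem_commutant hzz hb).symm.cfcₙ_nnreal NNReal.sqrt
    exact this.symm
  have hhp : h * p = h := by
    have : star (h * (1 - p)) * (h * (1 - p)) = 0 := by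
      rw [star_mul, hs, mul_assoc, ← mul_assoc h, hsq, mul_sub, mul_one, mul_assoc (star z), hzp,
        sub_self, mul_zero]
    rw [CStarRing.star_mul_self_eq_zero_iff, mul_sub, mul_one, sub_eq_zero] at this
    exact this.symm
  have hph : p * h = h := by simpa [hs, hps] using congrArg star hhp
  have hpos := hτ.pos (h - (t : ℂ) • p) (sub_mem hM (M.smul_mem' _ hp))
  have hexp : star (h - (t : ℂ) • p) * (h - (t : ℂ) • p)
      = star z * z - ((2 * t : ℝ) : ℂ) • h + ((t ^ 2 : ℝ) : ℂ) • p := by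
    simp only [star_sub, star_smul, hs, hps, sub_mul, mul_sub, smul_mul_assoc, mul_smul_comm, hhp,
      hph, hpp, hsq, RCLike.star_def, Complex.conj_ofReal]
    push_cast
    module
  rw [hexp, hτ.add _ (sub_mem hzz (M.smul_mem' _ hM)) _ (M.smul_mem' _ hp),
    hτ.sub hzz (M.smul_mem' _ hM), hτ.smul _ _ hM, hτ.smul _ _ hp] at hpos
  have := (Complex.le_def.1 hpos).1
  simp only [Complex.zero_re, Complex.add_re, Complex.sub_re, Complex.re_ofReal_mul] at this
  linarith

end IsFaithfulNormalTracialState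

/-- If `x ∈ M` is orthogonal to a MASA, some net of pinchings `z` of `x` tends to `0` in the
`L²`-sense `τ(x⋆ z) → 0`. -/
theorem IsMasa.tendsto_trace_pinching {M : VonNeumannAlgebra H}
    {A : StarSubalgebra ℂ (H →L[ℂ] H)} {τ : (H →L[ℂ] H) → ℂ} (hA : IsMasa M A)
    (hτ : IsFaithfulNormalTracialState M τ) {ι : Type*} (G : Ultrafilter ι)
    {P : ι → List (H →L[ℂ] H)} (hP : ∀ i, ∀ p ∈ P i, p ∈ A) {x : H →L[ℂ] H} (hx : x ∈ M)
    (hperp : ∀ a ∈ A, τ (star a * x) = 0)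
    (hnorm : ∀ i, ‖((P i).map fun p => p * x * p).sum‖ ≤ ‖x‖)
    (hcomm : ∀ q ∈ A, star q = q → q * q = q →
      ∀ᶠ i in G, Commute q ((P i).map fun p => p * x * p).sum) :
    Tendsto (fun i => τ (star x * ((P i).map fun p => p * x * p).sum)) G (𝓝 0) := by
  have hAM {a : H →L[ℂ] H} (ha : a ∈ A) : a ∈ M := ((hA a).1 ha).1
  have hpM (i : ι) : ∀ z ∈ (P i).map fun p => p * x * p, z ∈ M := by
    simp only [List.mem_map]
    rintro _ ⟨p, hp, rfl⟩
    exact mul_mem (mul_mem (hAM (hP i p hp)) hx) (hAM (hP i p hp))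
  have hzM (i : ι) : ((P i).map fun p => p * x * p).sum ∈ M := list_sum_mem (hpM i)
  have horth (i : ι) {a : H →L[ℂ] H} (ha : a ∈ A) :
      τ (star a * ((P i).map fun p => p * x * p).sum) = 0 := by
    rw [← List.sum_map_mul_left, hτ.list_sum]
    · refine List.sum_eq_zero ?_
      simp only [List.map_map, List.mem_map, Function.comp_apply]
      rintro _ ⟨p, hp, rfl⟩
      have hpA := hP i p hp
      rw [← mul_assoc, hτ.trace _ (mul_mem (star_mem (hAM ha)) (mul_mem (hAM hpA) hx)) _ (hAM hpA)]
      have := hperp (star (p * (star a * p))) (star_mem (mul_mem hpA (mul_mem (star_mem ha) hpA)))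
      simpa only [star_star, mul_assoc] using this
    · simp only [List.mem_map]
      rintro _ ⟨p, hp, rfl⟩
      exact mul_mem (star_mem (hAM ha)) (hpM i _ (List.mem_map.2 ⟨p, hp, rfl⟩))
  generalize hzdef : (fun i => ((P i).map fun p => p * x * p).sum) = z at *
  replace hzdef (i : ι) : ((P i).map fun p => p * x * p).sum = z i := congrFun hzdef i
  simp only [hzdef] at hnorm hcomm hzM horth ⊢
  obtain ⟨y, hy⟩ := exists_wot_limit G z ‖x‖ hnorm
  have hyM : y ∈ M := VonNeumannAlgebra.mem_of_wot_limit hzM hy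
  have hyA : y ∈ A := (hA y).2 ⟨hyM, fun a ha => hA.commute_of_commute_projections
    (fun q hq hqs hqq => commute_of_wot_limit hy (hcomm q hq hqs hqq)) ha⟩
  have hmul {a : H →L[ℂ] H} (ha : a ∈ M) :
      Tendsto (fun i => τ (star a * z i)) G (𝓝 (τ (star a * y))) := by
    refine hτ.tendsto_of_wot (fun i => mul_mem (star_mem ha) (hzM i)) (mul_mem (star_mem ha) hyM)
      (‖star a‖ * ‖x‖) (fun i => (norm_mul_le _ _).trans (by gcongr; exact hnorm i))
      fun v w => ?_
    simpa [ContinuousLinearMap.star_eq_adjoint, ContinuousLinearMap.adjoint_inner_left]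
      using hy v (a w)
  have hy0 : y = 0 := hτ.faithful y hyM <| tendsto_nhds_unique (hmul hyM) <| by
    simp only [horth _ hyA, tendsto_const_nhds]
  simpa [hy0, hτ.zero] using hmul hx

/-- If `X ⊂ M` is a finite set orthogonal to the MASA `A`, then for every `ε > 0` there is a
nonzero projection `q ∈ A` with `‖q x q‖₁ ≤ ε τ(q)` for all `x ∈ X`. -/
theorem stmt_19 (M : VonNeumannAlgebra H) (τ : (H →L[ℂ] H) → ℂ)
    (hτ : IsFaithfulNormalTracialState M τ)
    (A : StarSubalgebra ℂ (H →L[ℂ] H)) (hA : IsMasa M A)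
    (X : Finset (H →L[ℂ] H)) (hXM : ∀ x ∈ X, x ∈ M)
    (hXperp : ∀ x ∈ X, ∀ a ∈ A, τ (star a * x) = 0)
    (ε : ℝ) (hε : 0 < ε) :
    ∃ q : H →L[ℂ] H, q ∈ A ∧ star q = q ∧ q * q = q ∧ q ≠ 0 ∧
      ∀ x ∈ X, norm1 τ (q * x * q) ≤ ε * (τ q).re := by
  have hAM {a : H →L[ℂ] H} (ha : a ∈ A) : a ∈ M := ((hA a).1 ha).1
  choose P hP hPsum hPx using hA.exists_partition
  let G : Ultrafilter (Finset {q : H →L[ℂ] H // q ∈ A ∧ star q = q ∧ q * q = q}) :=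
    Ultrafilter.of atTop
  have hlim : ∀ x ∈ X,
      Tendsto (fun F => (τ (star x * ((P F).map fun p => p * x * p).sum)).re) G (𝓝 0) :=
    fun x hx => Complex.zero_re ▸ (Complex.continuous_re.tendsto 0).comp
      (hA.tendsto_trace_pinching hτ G (fun F p hp => (hP F p hp).1) (hXM x hx) (hXperp x hx)
        (fun F => (hPx F x).1) fun q hq hqs hqq => Ultrafilter.of_le atTop <|
          (eventually_ge_atTop {⟨q, hq, hqs, hqq⟩}).mono fun F hF =>
            (hPx F x).2 ⟨q, hq, hqs, hqq⟩ (Finset.singleton_subset_iff.1 hF))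
  have hsum := tendsto_finsetSum X hlim
  rw [Finset.sum_const_zero] at hsum
  obtain ⟨F, hF⟩ := (hsum.eventually_lt_const (by positivity : (0 : ℝ) < ε ^ 2)).exists
  have hpinch : ∀ x ∈ X, (τ (star x * ((P F).map fun p => p * x * p).sum)).re
      = ((P F).map fun p => (τ (star (p * x * p) * (p * x * p))).re).sum := by
    intro x hx
    have hxM := hXM x hx
    rw [← List.sum_map_mul_left, hτ.list_sum, ← Complex.reLm_coe, map_list_sum, List.map_map,
      List.map_map]
    · congr 1
      refine List.map_congr_left fun p hp => ?_
      obtain ⟨hpA, hps, hpp⟩ := hP F p hp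
      have hpM := hAM hpA
      simp only [Function.comp_apply, Complex.reLm_coe]
      have : star (p * x * p) * (p * x * p) = p * (star x * p * x * p) := by
        simp only [star_mul, hps, mul_assoc]
        rw [← mul_assoc p p, hpp]
      rw [this, hτ.trace _ hpM _ (mul_mem (mul_mem (mul_mem (star_mem hxM) hpM) hxM) hpM)]
      simp only [mul_assoc, hpp]
    · simp only [List.mem_map]
      rintro _ ⟨p, hp, rfl⟩
      have hpM := hAM (hP F p hp).1
      exact mul_mem (star_mem hxM) (mul_mem (mul_mem hpM hxM) hpM)
  have hone : ((P F).map fun p => (τ p).re).sum = 1 := by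
    have h := hτ.list_sum (P F) fun p hp => hAM (hP F p hp).1
    rw [hPsum, hτ.one] at h
    have := congrArg Complex.reLm h
    rw [map_list_sum, List.map_map] at this
    simpa [Function.comp_def] using this.symm
  obtain ⟨p, hp, hlt⟩ : ∃ p ∈ P F,
      ∑ x ∈ X, (τ (star (p * x * p) * (p * x * p))).re < ε ^ 2 * (τ p).re := by
    by_contra! hcon
    have h := List.sum_le_sum hcon
    rw [List.sum_map_mul_left, hone, mul_one] at h
    have hswap : ((P F).map fun p => ∑ x ∈ X, (τ (star (p * x * p) * (p * x * p))).re).sum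
        = ∑ x ∈ X, ((P F).map fun p => (τ (star (p * x * p) * (p * x * p))).re).sum := by
      induction P F with
      | nil => simp
      | cons a l ih => simp only [List.map_cons, List.sum_cons, ih, Finset.sum_add_distrib]
    rw [hswap, ← Finset.sum_congr rfl hpinch] at h
    exact h.not_gt hF
  obtain ⟨hpA, hps, hpp⟩ := hP F p hp
  have hpM := hAM hpA
  have hxp {x : H →L[ℂ] H} (hx : x ∈ X) : p * x * p ∈ M := mul_mem (mul_mem hpM (hXM x hx)) hpM
  have hnn : ∀ x ∈ X, 0 ≤ (τ (star (p * x * p) * (p * x * p))).re := fun x hx =>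
    (Complex.le_def.1 (hτ.pos _ (hxp hx))).1
  refine ⟨p, hpA, hps, hpp, ?_, fun x hx => ?_⟩
  · rintro rfl
    simp [hτ.zero] at hlt
  · have h1 := hτ.two_mul_norm1_le (hxp hx) hpM hps hpp (by rw [mul_assoc, hpp]) ε
    have h2 := Finset.single_le_sum hnn hx
    nlinarith

end
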